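/- Let G = ⟨a, b⟩ be a GGS-group acting on the p^n-adic tree with defining vector e, and let p^{R_0} be the largest power of p dividing all entries of e. Then the abelianization G/G′ is isomorphic to C_{p^n} × C_{p^{n−R_0}}. -/

import Mathlib

/-- The rooted automorphism `a` of the `d`-adic tree (vertices are words over
the alphabet `ZMod d`), acting as the cycle `(1 2 ⋯ d)` on first-level
vertices. -/
def ggsA (d : ℕ) : Equiv.Perm (List (ZMod d)) where
  toFun w := match w with
    | [] => []
    | u :: t => (u + 1) :: t
  invFun w := match w with
    | [] => []
    | u :: t => (u - 1) :: t
  left_inv w := by cases w <;> simp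
  right_inv w := by cases w <;> simp

/-- The underlying function of the directed automorphism `b` with defining
vector `e`, satisfying `ψ(b) = (a^{e_1}, …, a^{e_{d-1}}, b)` (the letter `0`
plays the role of the last letter `d`). -/
def ggsBFun (d : ℕ) (e : ZMod d → ZMod d) : List (ZMod d) → List (ZMod d)
  | [] => []
  | u :: t => u :: (if u = 0 then ggsBFun d e t else (ggsA d ^ (e u).val) t)

/-- The inverse of `ggsBFun`. -/
def ggsBInv (d : ℕ) (e : ZMod d → ZMod d) : List (ZMod d) → List (ZMod d)
  | [] => []
  | u :: t => u :: (if u = 0 then ggsBInv d e t else ((ggsA d ^ (e u).val)⁻¹) t)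

theorem ggsB_left_inv (d : ℕ) (e : ZMod d → ZMod d) :
    ∀ w, ggsBInv d e (ggsBFun d e w) = w := by
  intro w
  induction w with
  | nil => rfl
  | cons u t ih =>
      by_cases hu : u = 0 <;> simp [ggsBFun, ggsBInv, hu, ih]

theorem ggsB_right_inv (d : ℕ) (e : ZMod d → ZMod d) :
    ∀ w, ggsBFun d e (ggsBInv d e w) = w := by
  intro w
  induction w with
  | nil => rfl
  | cons u t ih =>
      by_cases hu : u = 0 <;> simp [ggsBFun, ggsBInv, hu, ih]

/-- The directed automorphism `b` of the `d`-adic tree with defining vector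
`e`, given recursively by `ψ(b) = (a^{e_1}, …, a^{e_{d-1}}, b)`. -/
def ggsB (d : ℕ) (e : ZMod d → ZMod d) : Equiv.Perm (List (ZMod d)) where
  toFun := ggsBFun d e
  invFun := ggsBInv d e
  left_inv := ggsB_left_inv d e
  right_inv := ggsB_right_inv d e

/-- The GGS-group `G = ⟨a, b⟩` acting on the `d`-adic tree with defining
vector `e`. -/
def ggsGroup (d : ℕ) (e : ZMod d → ZMod d) :
    Subgroup (Equiv.Perm (List (ZMod d))) :=
  Subgroup.closure {ggsA d, ggsB d e}

@[simp] theorem ggsA_nil (d : ℕ) : ggsA d [] = [] := rfl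

@[simp] theorem ggsA_cons (d : ℕ) (u : ZMod d) (t : List (ZMod d)) :
    ggsA d (u :: t) = (u + 1) :: t := rfl

@[simp] theorem ggsB_nil (d : ℕ) (e : ZMod d → ZMod d) : ggsB d e [] = [] := rfl

@[simp] theorem ggsB_cons (d : ℕ) (e : ZMod d → ZMod d) (u : ZMod d) (t : List (ZMod d)) :
    ggsB d e (u :: t) = u :: (if u = 0 then ggsB d e t else (ggsA d ^ (e u).val) t) := rfl

theorem ggsA_pow_nil (d m : ℕ) : (ggsA d ^ m) [] = [] := by
  induction m with
  | zero => rfl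
  | succ m ih => simp [pow_succ', ih]

theorem ggsA_pow_cons (d m : ℕ) (u : ZMod d) (t : List (ZMod d)) :
    (ggsA d ^ m) (u :: t) = (u + m) :: t := by
  induction m with
  | zero => simp
  | succ m ih => simp [pow_succ', ih, add_assoc]

theorem ggsA_pow_eq_one {d m : ℕ} (h : d ∣ m) : ggsA d ^ m = 1 := by
  ext1 w
  cases w with
  | nil => exact ggsA_pow_nil d m
  | cons u t => simp [ggsA_pow_cons, (ZMod.natCast_eq_zero_iff m d).2 h]

theorem ggsA_zpow_eq_one {d : ℕ} {m : ℤ} (h : (m : ZMod d) = 0) : ggsA d ^ m = 1 := by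
  obtain ⟨c, rfl⟩ := (ZMod.intCast_zmod_eq_zero_iff_dvd m d).1 h
  rw [zpow_mul, zpow_natCast, ggsA_pow_eq_one dvd_rfl, one_zpow]

theorem ggsB_pow_nil (d : ℕ) (e : ZMod d → ZMod d) (m : ℕ) : (ggsB d e ^ m) [] = [] := by
  induction m with
  | zero => rfl
  | succ m ih => simp [pow_succ', ih]

theorem ggsB_pow_cons (d : ℕ) (e : ZMod d → ZMod d) (m : ℕ) (u : ZMod d) (t : List (ZMod d)) :
    (ggsB d e ^ m) (u :: t) =
      u :: (if u = 0 then (ggsB d e ^ m) t else (ggsA d ^ (m * (e u).val)) t) := by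
  induction m with
  | zero => simp
  | succ m ih =>
    rw [pow_succ', Equiv.Perm.mul_apply, ih, ggsB_cons]
    split_ifs
    · rfl
    · rw [Nat.succ_mul, add_comm, pow_add, Equiv.Perm.mul_apply]

theorem ggsB_pow_eq_one {d m : ℕ} {e : ZMod d → ZMod d} (h : ∀ u, d ∣ m * (e u).val) :
    ggsB d e ^ m = 1 := by
  ext1 w
  induction w with
  | nil => exact ggsB_pow_nil d e m
  | cons u t ih => simpa [ggsB_pow_cons, ggsA_pow_eq_one (h u)] using fun _ => ih

theorem dvd_mul_val_of_ggsB_pow_eq_one {d m : ℕ} {e : ZMod d → ZMod d} (he0 : e 0 = 0)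
    (h : ggsB d e ^ m = 1) (u : ZMod d) : d ∣ m * (e u).val := by
  by_cases hu : u = 0
  · simp [hu, he0]
  · have h1 := congrArg (fun g => g [u, 0]) h
    simp only [ggsB_pow_cons, if_neg hu, ggsA_pow_cons, Equiv.Perm.one_apply, List.cons.injEq,
      and_true, true_and, zero_add] at h1
    exact (ZMod.natCast_eq_zero_iff _ _).1 h1

/-- `GGSWord d e g k r` says that `g` is the value of a positive word in the generators
`a` and `b` with `k` occurrences of `a` and `r` occurrences of `b`. -/
inductive GGSWord (d : ℕ) (e : ZMod d → ZMod d) : Equiv.Perm (List (ZMod d)) → ℕ → ℕ → Prop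
  | one : GGSWord d e 1 0 0
  | mul_a {g : Equiv.Perm (List (ZMod d))} {k r : ℕ} :
      GGSWord d e g k r → GGSWord d e (ggsA d * g) (k + 1) r
  | mul_b {g : Equiv.Perm (List (ZMod d))} {k r : ℕ} :
      GGSWord d e g k r → GGSWord d e (ggsB d e * g) k (r + 1)

namespace GGSWord

variable {d : ℕ} {e : ZMod d → ZMod d} {g h : Equiv.Perm (List (ZMod d))} {k r k' r' : ℕ}

theorem mul (hg : GGSWord d e g k r) (hh : GGSWord d e h k' r') :
    GGSWord d e (g * h) (k + k') (r + r') := by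
  induction hg with
  | one => simpa using hh
  | mul_a _ ih => rw [mul_assoc, add_right_comm]; exact ih.mul_a
  | mul_b _ ih => rw [mul_assoc, add_right_comm]; exact ih.mul_b

theorem a_pow (m : ℕ) : GGSWord d e (ggsA d ^ m) m 0 := by
  induction m with
  | zero => exact one
  | succ m ih => rw [pow_succ']; exact ih.mul_a

theorem b_pow (m : ℕ) : GGSWord d e (ggsB d e ^ m) 0 m := by
  induction m with
  | zero => exact one
  | succ m ih => rw [pow_succ']; exact ih.mul_b

theorem mem (hg : GGSWord d e g k r) : g ∈ ggsGroup d e := by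
  induction hg with
  | one => exact one_mem _
  | mul_a _ ih => exact mul_mem (Subgroup.subset_closure (by simp)) ih
  | mul_b _ ih => exact mul_mem (Subgroup.subset_closure (by simp)) ih

/-- The sections at the first level of a word with `r` letters `b` are words sharing these letters
between them; if one section receives them all, the word is a conjugate of `b ^ r` up to a
power of `a`. -/
theorem exists_sections [NeZero d] (hg : GGSWord d e g k r) :
    ∃ (s : ZMod d → Equiv.Perm (List (ZMod d))) (c m : ZMod d → ℕ),
      (∀ u t, g (u :: t) = (u + k) :: s u t) ∧ (∀ u, GGSWord d e (s u) (c u) (m u)) ∧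
      ∑ u, m u = r ∧
      ∀ j : ℤ, m j = r → g = ggsA d ^ (k + j) * ggsB d e ^ r * ggsA d ^ (-j) := by
  induction hg with
  | one => exact ⟨fun _ => 1, fun _ => 0, fun _ => 0, by simp, fun _ => one, by simp, by simp⟩
  | @mul_a g k r _ ih =>
    obtain ⟨s, c, m, h1, h2, h3, h4⟩ := ih
    refine ⟨s, c, m, fun u t => ?_, h2, h3, fun j hj => ?_⟩
    · simp [h1, add_assoc]
    · conv_lhs => rw [h4 j hj]
      push_cast
      rw [← mul_assoc, ← mul_assoc, ← zpow_one_add]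
      congr 3
      ring
  | @mul_b g k r _ ih =>
    obtain ⟨s, c, m, h1, h2, h3, h4⟩ := ih
    refine ⟨fun u => (if u + k = 0 then ggsB d e else ggsA d ^ (e (u + k)).val) * s u,
      fun u => (if u + k = 0 then 0 else (e (u + k)).val) + c u,
      fun u => (if u + k = 0 then 1 else 0) + m u, fun u t => ?_, fun u => ?_, ?_, fun j hj => ?_⟩
    · rw [Equiv.Perm.mul_apply, h1, ggsB_cons]
      dsimp only
      split_ifs <;> rfl
    · refine GGSWord.mul ?_ (h2 u)
      split_ifs
      · simpa using b_pow (e := e) 1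
      · exact a_pow _
    · simp [Finset.sum_add_distrib, h3, add_eq_zero_iff_eq_neg, add_comm]
    · have hle : m j ≤ r := h3 ▸ Finset.single_le_sum (fun _ _ => Nat.zero_le _) (Finset.mem_univ _)
      dsimp only at hj
      split_ifs at hj with h0
      · have ha : ggsA d ^ ((k : ℤ) + j) = 1 :=
          ggsA_zpow_eq_one (by push_cast; rw [add_comm]; exact h0)
        conv_lhs => rw [h4 j (by omega), ha]
        rw [ha, one_mul, one_mul, pow_succ', mul_assoc]
      · omega

theorem dvd_left [NeZero d] (hg : GGSWord d e 1 k r) : d ∣ k := by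
  obtain ⟨s, _, _, h1, _⟩ := hg.exists_sections
  have h := h1 0 []
  simp only [Equiv.Perm.one_apply, List.cons.injEq, zero_add] at h
  exact (ZMod.natCast_eq_zero_iff _ _).1 h.1.symm

theorem dvd_right [NeZero d] {N : ℕ} (hN : ∀ r, ggsB d e ^ r = 1 → N ∣ r)
    (hg : GGSWord d e 1 k r) : N ∣ r := by
  induction r using Nat.strong_induction_on generalizing k with
  | _ r ih =>
    obtain ⟨s, c, m, h1, h2, h3, h4⟩ := hg.exists_sections
    have hs : ∀ u, s u = 1 := fun u => by
      ext1 t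
      have h := h1 u t
      simp only [Equiv.Perm.one_apply, List.cons.injEq] at h
      exact h.2.symm
    by_cases hm : ∃ u, m u = r
    · obtain ⟨u, hu⟩ := hm
      obtain ⟨j, rfl⟩ := ZMod.intCast_surjective u
      apply hN
      have h := h4 j hu
      rw [zpow_add, zpow_natCast, ggsA_pow_eq_one hg.dvd_left, one_mul, zpow_neg] at h
      simpa using conj_eq_one_iff.1 h.symm
    · push Not at hm
      rw [← h3]
      refine Finset.dvd_sum fun u _ => ?_
      have hle : m u ≤ r := h3 ▸ Finset.single_le_sum (fun _ _ => Nat.zero_le _) (Finset.mem_univ _)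
      have h := h2 u
      rw [hs] at h
      exact ih _ (lt_of_le_of_ne hle (hm u)) h

theorem exists_of_mem [NeZero d] {N : ℕ} (hN0 : 0 < N) (hb : ggsB d e ^ N = 1)
    (hg : g ∈ ggsGroup d e) : ∃ k r, GGSWord d e g k r := by
  have hinv : ∀ {x k r}, GGSWord d e x k r → ∃ k r, GGSWord d e x⁻¹ k r := by
    intro x k r hx
    induction hx with
    | one => exact ⟨0, 0, by simpa using one⟩
    | mul_a _ ih =>
      obtain ⟨k, r, h⟩ := ih
      have hi : ggsA d ^ (d - 1) = (ggsA d)⁻¹ := eq_inv_of_mul_eq_one_left <| by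
        rw [← pow_succ, Nat.sub_add_cancel (NeZero.pos d), ggsA_pow_eq_one dvd_rfl]
      have h' := h.mul (a_pow (d - 1))
      rw [hi, ← mul_inv_rev] at h'
      exact ⟨_, _, h'⟩
    | mul_b _ ih =>
      obtain ⟨k, r, h⟩ := ih
      have hi : ggsB d e ^ (N - 1) = (ggsB d e)⁻¹ := eq_inv_of_mul_eq_one_left <| by
        rw [← pow_succ, Nat.sub_add_cancel hN0, hb]
      have h' := h.mul (b_pow (N - 1))
      rw [hi, ← mul_inv_rev] at h'
      exact ⟨_, _, h'⟩
  induction hg using Subgroup.closure_induction with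
  | mem x hx =>
    rcases hx with rfl | rfl
    · exact ⟨_, _, by simpa using a_pow (e := e) 1⟩
    · exact ⟨_, _, by simpa using b_pow (e := e) 1⟩
  | one => exact ⟨0, 0, one⟩
  | mul x y _ _ hx hy =>
    obtain ⟨_, _, hx⟩ := hx
    obtain ⟨_, _, hy⟩ := hy
    exact ⟨_, _, hx.mul hy⟩
  | inv x _ hx =>
    obtain ⟨_, _, hx⟩ := hx
    exact hinv hx

theorem abelianization_of (hg : GGSWord d e g k r) :
    Abelianization.of (⟨g, hg.mem⟩ : ggsGroup d e) =
      Abelianization.of ⟨ggsA d, Subgroup.subset_closure (by simp)⟩ ^ k *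
        Abelianization.of ⟨ggsB d e, Subgroup.subset_closure (by simp)⟩ ^ r := by
  induction hg with
  | one => rw [pow_zero, pow_zero, mul_one]; exact map_one _
  | mul_a hg ih =>
    rw [pow_succ', mul_assoc, ← ih, ← map_mul]
    rfl
  | mul_b hg ih =>
    rw [pow_succ', mul_left_comm, ← ih, ← map_mul]
    rfl

end GGSWord

/-- If `b` has order `N`, the abelianization of the GGS-group is `C_d × C_N`. -/
theorem ggsGroup_abelianization {d N : ℕ} [NeZero d] [NeZero N] {e : ZMod d → ZMod d}
    (hN : ∀ r, ggsB d e ^ r = 1 ↔ N ∣ r) :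
    Nonempty (Abelianization (ggsGroup d e) ≃*
      Multiplicative (ZMod d) × Multiplicative (ZMod N)) := by
  have hb : ggsB d e ^ N = 1 := (hN N).2 dvd_rfl
  have hex : ∀ g ∈ ggsGroup d e, ∃ k r, GGSWord d e g k r :=
    fun g hg => GGSWord.exists_of_mem (NeZero.pos N) hb hg
  have huniq : ∀ {g k r k' r'}, GGSWord d e g k r → GGSWord d e g k' r' →
      (k : ZMod d) = k' ∧ (r : ZMod N) = r' := by
    intro g k r k' r' h h'
    obtain ⟨l, q, hi⟩ := hex _ (inv_mem h.mem)
    have h1 := h.mul hi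
    have h2 := h'.mul hi
    rw [mul_inv_cancel] at h1 h2
    have a1 := (ZMod.natCast_eq_zero_iff _ _).2 h1.dvd_left
    have a2 := (ZMod.natCast_eq_zero_iff _ _).2 h2.dvd_left
    have b1 := (ZMod.natCast_eq_zero_iff _ _).2 (h1.dvd_right fun r => (hN r).1)
    have b2 := (ZMod.natCast_eq_zero_iff _ _).2 (h2.dvd_right fun r => (hN r).1)
    push_cast at a1 a2 b1 b2
    exact ⟨add_right_cancel (a1.trans a2.symm), add_right_cancel (b1.trans b2.symm)⟩
  choose! k r hkr using hex
  let f : ggsGroup d e →* Multiplicative (ZMod d) × Multiplicative (ZMod N) :=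
    MonoidHom.mk' (fun g => (.ofAdd (k g : ZMod d), .ofAdd (r g : ZMod N))) fun g h => by
      obtain ⟨h1, h2⟩ := huniq (hkr _ (g * h).2) ((hkr _ g.2).mul (hkr _ h.2))
      rw [h1, h2]
      push_cast
      rfl
  refine ⟨MulEquiv.ofBijective (Abelianization.lift f) ⟨?_, fun x => ?_⟩⟩
  · rw [injective_iff_map_eq_one]
    intro x hx
    obtain ⟨g, rfl⟩ := QuotientGroup.mk_surjective x
    change f g = 1 at hx
    have h1 : (k g : ZMod d) = 0 := congrArg (fun y => y.1.toAdd) hx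
    have h2 : (r g : ZMod N) = 0 := congrArg (fun y => y.2.toAdd) hx
    rw [ZMod.natCast_eq_zero_iff] at h1 h2
    refine (hkr g g.2).abelianization_of.trans ?_
    rw [← map_pow, ← map_pow, ← map_mul]
    refine (congrArg Abelianization.of (Subtype.ext ?_)).trans (map_one _)
    simp [ggsA_pow_eq_one h1, (hN _).2 h2]
  · have hw := (GGSWord.a_pow (e := e) x.1.toAdd.val).mul (GGSWord.b_pow x.2.toAdd.val)
    refine ⟨Abelianization.of ⟨_, hw.mem⟩, ?_⟩
    obtain ⟨h1, h2⟩ := huniq (hkr _ hw.mem) hw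
    rw [Abelianization.lift_apply_of]
    refine Prod.ext ?_ ?_
    · exact congrArg Multiplicative.ofAdd (h1.trans (by rw [add_zero, ZMod.natCast_zmod_val]; rfl))
    · exact congrArg Multiplicative.ofAdd (h2.trans (by rw [zero_add, ZMod.natCast_zmod_val]; rfl))

/-- For a GGS-group `G = ⟨a,b⟩` on the `p^n`-adic tree with nonzero defining
vector `e`, where `p^{R₀}` is the largest power of `p` dividing all entries of
`e`, the abelianization `G/G'` is isomorphic to `C_{p^n} × C_{p^{n-R₀}}`. -/
theorem ggs_abelianization (p n : ℕ) (hp : p.Prime) (hn : 1 ≤ n)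
    (e : ZMod (p ^ n) → ZMod (p ^ n)) (he0 : e 0 = 0) (hne : ∃ i, e i ≠ 0)
    (R₀ : ℕ) (hdvd : ∀ i, p ^ R₀ ∣ (e i).val)
    (hmax : ∃ i, ¬ p ^ (R₀ + 1) ∣ (e i).val) :
    Nonempty (Abelianization (ggsGroup (p ^ n) e) ≃*
      Multiplicative (ZMod (p ^ n)) × Multiplicative (ZMod (p ^ (n - R₀)))) := by
  have : NeZero (p ^ n) := ⟨pow_ne_zero _ hp.ne_zero⟩
  have : NeZero (p ^ (n - R₀)) := ⟨pow_ne_zero _ hp.ne_zero⟩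
  have hR : R₀ ≤ n := by
    obtain ⟨i, hi⟩ := hne
    have h0 : 0 < (e i).val := Nat.pos_of_ne_zero ((ZMod.val_ne_zero _).2 hi)
    exact ((Nat.pow_lt_pow_iff_right hp.one_lt).1
      ((Nat.le_of_dvd h0 (hdvd i)).trans_lt (ZMod.val_lt _))).le
  have hpn : p ^ n = p ^ (n - R₀) * p ^ R₀ := by rw [← pow_add, Nat.sub_add_cancel hR]
  refine ggsGroup_abelianization fun r => ⟨fun h => ?_, fun h => ggsB_pow_eq_one fun u => ?_⟩
  · obtain ⟨i, hi⟩ := hmax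
    have hd := dvd_mul_val_of_ggsB_pow_eq_one he0 h i
    obtain ⟨c, hc⟩ := hdvd i
    have hpc : ¬ p ∣ c := fun hpc => hi (by rw [hc, pow_succ]; exact mul_dvd_mul_left _ hpc)
    have hcop : Nat.Coprime (p ^ (n - R₀)) c :=
      Nat.Coprime.pow_left _ ((Nat.Prime.coprime_iff_not_dvd hp).2 hpc)
    have hd' : p ^ (n - R₀) * p ^ R₀ ∣ r * c * p ^ R₀ := by
      rwa [← hpn, mul_assoc, mul_comm c, ← hc]
    exact hcop.dvd_of_dvd_mul_right
      (Nat.dvd_of_mul_dvd_mul_right (pow_pos hp.pos _) hd')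
  · exact hpn.dvd.trans (mul_dvd_mul h (hdvd u))
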